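/- arXiv:1401.2422 — 6 statements merged into one kernel-verified Lean document; each statement's English description precedes it below -/
import Mathlib

section
/- Let C be an [n,k] linear code over a field F with 1 ≤ k ≤ n−1. The dual code C^⊥ has dimension n−k and hence exactly k gaps g^⊥_1 < g^⊥_2 < … < g^⊥_k. Then for every 1 ≤ i ≤ k, the i-th generalized Hamming weight of C satisfies d_i(C) = (n+1) − g^⊥_{k−i+1}. In particular, the minimum distance satisfies d_min(C) = d_1(C) = (n+1) − g^⊥_k. -/
open Classical in
/-- The support of a vector: the set of coordinates where it is nonzero. -/
noncomputable def vsupp {F : Type*} [Field F] {n : ℕ} (v : Fin n → F) : Finset (Fin n) :=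
  Finset.univ.filter (fun i => v i ≠ 0)

open Classical in
/-- The support of a subspace: the union of the supports of its vectors. -/
noncomputable def codeSupp {F : Type*} [Field F] {n : ℕ}
    (D : Submodule F (Fin n → F)) : Finset (Fin n) :=
  Finset.univ.filter (fun i => ∃ v ∈ D, v i ≠ 0)

/-- The dual code w.r.t. the standard bilinear form `⟨x,y⟩ = ∑ x i * y i`. -/
def dualCode {F : Type*} [Field F] {n : ℕ} (C : Submodule F (Fin n → F)) :
    Submodule F (Fin n → F) where
  carrier := {w | ∀ v ∈ C, ∑ i, v i * w i = 0}
  zero_mem' := by intro v _; simp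
  add_mem' := by
    intro a b ha hb v hv
    have h : ∑ i, v i * (a + b) i = (∑ i, v i * a i) + ∑ i, v i * b i := by
      simp [mul_add, Finset.sum_add_distrib]
    rw [h, ha v hv, hb v hv, add_zero]
  smul_mem' := by
    intro c a ha v hv
    have h : ∑ i, v i * (c • a) i = c * ∑ i, v i * a i := by
      simp [Finset.mul_sum, mul_left_comm]
    rw [h, ha v hv, mul_zero]

/-- The `i`-th generalized Hamming weight (1-indexed): the minimum support cardinality
of an `i`-dimensional subspace. -/
noncomputable def ghw {F : Type*} [Field F] {n : ℕ} (C : Submodule F (Fin n → F)) (i : ℕ) : ℕ :=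
  sInf {s | ∃ D : Submodule F (Fin n → F), D ≤ C ∧ Module.finrank F D = i ∧ (codeSupp D).card = s}

/-- The set of gaps of a code: elements of `{1,…,n}` that are not generalized Hamming weights. -/
noncomputable def gapSet {F : Type*} [Field F] {n : ℕ} (C : Submodule F (Fin n → F)) : Finset ℕ :=
  (Finset.Icc 1 n) \ ((Finset.Icc 1 (Module.finrank F C)).image (ghw C))

/-- The `i`-th gap of a code (1-indexed), via the increasing enumeration of the gap set. -/
noncomputable def gapNum {F : Type*} [Field F] {n : ℕ} (C : Submodule F (Fin n → F)) (i : ℕ) : ℕ :=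
  ((gapSet C).sort (· ≤ ·)).getD (i - 1) 0

/-- The minimum distance of a code: the minimum Hamming weight of a nonzero codeword. -/
noncomputable def dmin {F : Type*} [Field F] {n : ℕ} (C : Submodule F (Fin n → F)) : ℕ :=
  sInf {w | ∃ v ∈ C, v ≠ 0 ∧ (vsupp v).card = w}

/-- `S` is an `ℓ`-core (`ℓ = S.card`) of `B` if no nonzero codeword of `B`
has its support contained in `S`. -/
def isCore {F : Type*} [Field F] {n : ℕ} (B : Submodule F (Fin n → F)) (S : Finset (Fin n)) : Prop :=
  ∀ v ∈ B, v ≠ 0 → ¬ (vsupp v ⊆ S)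

/-- The subspace of the dual code spanned by all its codewords of Hamming weight `≤ r+1`. -/
noncomputable def lowWtSpan {F : Type*} [Field F] {n : ℕ}
    (C : Submodule F (Fin n → F)) (r : ℕ) : Submodule F (Fin n → F) :=
  Submodule.span F {c | c ∈ dualCode C ∧ (vsupp c).card ≤ r + 1}

/-- `A_i`: the set of local parities covering coordinate `i`, i.e. dual codewords of
Hamming weight at most `r+1` whose support contains `i`. -/
def coveringParities {F : Type*} [Field F] {n : ℕ}
    (C : Submodule F (Fin n → F)) (r : ℕ) (i : Fin n) : Set (Fin n → F) :=
  {c | c ∈ dualCode C ∧ (vsupp c).card ≤ r + 1 ∧ c i ≠ 0}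

/-- `C` is locally 2-reconstructible with locality `r`: every `A_i` is nonempty
and `A_i ≠ A_j` for `i ≠ j`. -/
def Locally2Recon {F : Type*} [Field F] {n : ℕ}
    (C : Submodule F (Fin n → F)) (r : ℕ) : Prop :=
  (∀ i : Fin n, (coveringParities C r i).Nonempty) ∧
  (∀ i j : Fin n, i ≠ j → coveringParities C r i ≠ coveringParities C r j)

section WeiDuality

open Module

variable {F : Type*} [Field F] {n : ℕ}

/-- The coordinate subspace of the vectors whose support is contained in `S`. -/
def coordSubspace (F : Type*) [Field F] {n : ℕ} (S : Finset (Fin n)) :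
    Submodule F (Fin n → F) :=
  ⨅ i ∈ ((Sᶜ : Finset (Fin n)) : Set (Fin n)),
    LinearMap.ker (LinearMap.proj i : (Fin n → F) →ₗ[F] F)

theorem mem_coordSubspace {S : Finset (Fin n)} {v : Fin n → F} :
    v ∈ coordSubspace F S ↔ ∀ i, i ∉ S → v i = 0 := by
  simp [coordSubspace]

theorem coordSubspace_mono {S T : Finset (Fin n)} (h : S ⊆ T) :
    coordSubspace F S ≤ coordSubspace F T := fun _ hv =>
  mem_coordSubspace.2 fun i hi => mem_coordSubspace.1 hv i fun hS => hi (h hS)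

theorem mem_codeSupp {D : Submodule F (Fin n → F)} {i : Fin n} :
    i ∈ codeSupp D ↔ ∃ v ∈ D, v i ≠ 0 := by
  simp [codeSupp]

theorem le_coordSubspace_iff {D : Submodule F (Fin n → F)} {S : Finset (Fin n)} :
    D ≤ coordSubspace F S ↔ codeSupp D ⊆ S := by
  constructor
  · intro h i hi
    obtain ⟨v, hv, hvi⟩ := mem_codeSupp.1 hi
    by_contra hS
    exact hvi (mem_coordSubspace.1 (h hv) i hS)
  · intro h v hv
    refine mem_coordSubspace.2 fun i hi => ?_
    by_contra hvi
    exact hi (h (mem_codeSupp.2 ⟨v, hv, hvi⟩))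

theorem finrank_coordSubspace (S : Finset (Fin n)) :
    finrank F (coordSubspace F S) = S.card := by
  have e := LinearMap.iInfKerProjEquiv F (fun _ : Fin n => F)
    (I := (S : Set (Fin n))) (J := ((Sᶜ : Finset (Fin n)) : Set (Fin n)))
    (by simpa using disjoint_compl_right) (by simp)
  rw [coordSubspace, e.finrank_eq]
  simp

theorem mem_dualCode {C : Submodule F (Fin n → F)} {w : Fin n → F} :
    w ∈ dualCode C ↔ ∀ v ∈ C, ∑ i, v i * w i = 0 := Iff.rfl

theorem dualCode_eq_orthogonal (C : Submodule F (Fin n → F)) :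
    dualCode C = (Matrix.toBilin' (1 : Matrix (Fin n) (Fin n) F)).orthogonal C := by
  ext w
  simp [mem_dualCode, Matrix.toBilin'_apply', dotProduct]

theorem finrank_dualCode (C : Submodule F (Fin n → F)) :
    finrank F (dualCode C) = n - finrank F C := by
  rw [dualCode_eq_orthogonal, LinearMap.BilinForm.finrank_orthogonal
    (LinearMap.BilinForm.nondegenerate_toBilin'_of_det_ne_zero' _ (by simp))]
  simp

theorem dualCode_inf_coordSubspace (C : Submodule F (Fin n → F)) (S : Finset (Fin n)) :
    dualCode C ⊓ coordSubspace F S = dualCode (C ⊔ coordSubspace F Sᶜ) := by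
  ext w
  rw [Submodule.mem_inf, mem_dualCode, mem_dualCode, mem_coordSubspace]
  constructor
  · rintro ⟨hC, hS⟩ v hv
    obtain ⟨a, ha, b, hb, rfl⟩ := Submodule.mem_sup.1 hv
    have hb0 : ∑ i, b i * w i = 0 := Finset.sum_eq_zero fun i _ => by
      by_cases hi : i ∈ S
      · rw [mem_coordSubspace.1 hb i (by simpa using hi), zero_mul]
      · rw [hS i hi, mul_zero]
    simp [add_mul, Finset.sum_add_distrib, hC a ha, hb0]
  · intro h
    refine ⟨fun v hv => h v (Submodule.mem_sup_left hv), fun i hi => ?_⟩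
    have := h (Pi.single i 1) (Submodule.mem_sup_right (mem_coordSubspace.2 fun j hj => by
      have hji : j ≠ i := by rintro rfl; exact hj (by simpa using hi)
      simp [hji]))
    simpa [Pi.single_apply] using this

theorem finrank_dualCode_inf_coordSubspace (C : Submodule F (Fin n → F)) (S : Finset (Fin n)) :
    finrank F ↥(dualCode C ⊓ coordSubspace F S) + finrank F C =
      S.card + finrank F ↥(C ⊓ coordSubspace F Sᶜ) := by
  have h := Submodule.finrank_sup_add_finrank_inf_eq C (coordSubspace F Sᶜ)
  have hle := (C ⊔ coordSubspace F Sᶜ).finrank_le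
  have hS := Finset.card_add_card_compl S
  rw [finrank_coordSubspace] at h
  rw [dualCode_inf_coordSubspace, finrank_dualCode]
  simp only [finrank_fin_fun, Fintype.card_fin] at hle hS
  lia

/-- The dimension/length profile: the maximal dimension of a subcode of `C` supported on
`s` coordinates. -/
noncomputable def dimProfile (C : Submodule F (Fin n → F)) (s : ℕ) : ℕ :=
  (Finset.powersetCard s Finset.univ).sup fun S => finrank F ↥(C ⊓ coordSubspace F S)

theorem finrank_inf_coordSubspace_le_dimProfile (C : Submodule F (Fin n → F))
    (S : Finset (Fin n)) : finrank F ↥(C ⊓ coordSubspace F S) ≤ dimProfile C S.card :=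
  Finset.le_sup (f := fun S => finrank F ↥(C ⊓ coordSubspace F S)) (by simp)

theorem exists_finrank_eq_dimProfile (C : Submodule F (Fin n → F)) {s : ℕ} (hs : s ≤ n) :
    ∃ S : Finset (Fin n), S.card = s ∧ finrank F ↥(C ⊓ coordSubspace F S) = dimProfile C s := by
  obtain ⟨S, hS, h⟩ := Finset.exists_mem_eq_sup (Finset.powersetCard s (Finset.univ))
    (Finset.powersetCard_nonempty.2 (by simpa using hs))
    fun S : Finset (Fin n) => finrank F ↥(C ⊓ coordSubspace F S)
  exact ⟨S, (Finset.mem_powersetCard.1 hS).2, h.symm⟩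

theorem dimProfile_le_finrank (C : Submodule F (Fin n → F)) (s : ℕ) :
    dimProfile C s ≤ finrank F C :=
  Finset.sup_le fun _ _ => Submodule.finrank_mono inf_le_left

theorem dimProfile_zero (C : Submodule F (Fin n → F)) : dimProfile C 0 = 0 := by
  obtain ⟨S, hS, h⟩ := exists_finrank_eq_dimProfile C (Nat.zero_le n)
  have := Submodule.finrank_mono (inf_le_right : C ⊓ coordSubspace F S ≤ _)
  rw [finrank_coordSubspace] at this
  lia

theorem dimProfile_mono (C : Submodule F (Fin n → F)) {s t : ℕ} (hst : s ≤ t) (ht : t ≤ n) :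
    dimProfile C s ≤ dimProfile C t := by
  obtain ⟨S, hS, h⟩ := exists_finrank_eq_dimProfile C (hst.trans ht)
  obtain ⟨T, hST, -, hT⟩ := Finset.exists_subsuperset_card_eq (Finset.subset_univ S)
    (hS.trans_le hst) (by simpa using ht)
  rw [← h, ← hT]
  exact (Submodule.finrank_mono (inf_le_inf_left C (coordSubspace_mono hST))).trans
    (finrank_inf_coordSubspace_le_dimProfile C T)

theorem dimProfile_dualCode (C : Submodule F (Fin n → F)) {s : ℕ} (hs : s ≤ n) :
    dimProfile (dualCode C) s + finrank F C = s + dimProfile C (n - s) := by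
  apply le_antisymm
  · obtain ⟨S, rfl, h⟩ := exists_finrank_eq_dimProfile (dualCode C) hs
    rw [← h, finrank_dualCode_inf_coordSubspace]
    simpa [Finset.card_compl] using finrank_inf_coordSubspace_le_dimProfile C Sᶜ
  · obtain ⟨T, hT, h⟩ := exists_finrank_eq_dimProfile C (Nat.sub_le n s)
    have hc : Tᶜ.card = s := by
      rw [Finset.card_compl, hT, Fintype.card_fin]
      lia
    have := finrank_dualCode_inf_coordSubspace C Tᶜ
    rw [compl_compl, h, hc] at this
    rw [← this, ← hc]
    exact Nat.add_le_add_right (finrank_inf_coordSubspace_le_dimProfile _ _) _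

theorem dimProfile_succ_le (C : Submodule F (Fin n → F)) {s : ℕ} (hs : s + 1 ≤ n) :
    dimProfile C (s + 1) ≤ dimProfile C s + 1 := by
  have h₁ := dimProfile_dualCode C (Nat.sub_le n s)
  have h₂ := dimProfile_dualCode C (Nat.sub_le n (s + 1))
  have h₃ := dimProfile_mono (dualCode C) (by lia : n - (s + 1) ≤ n - s) (Nat.sub_le n s)
  rw [Nat.sub_sub_self (by lia)] at h₁ h₂
  lia

theorem exists_le_finrank_eq (D : Submodule F (Fin n → F)) {i : ℕ} (hi : i ≤ finrank F D) :
    ∃ E ≤ D, finrank F E = i := by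
  obtain ⟨f, hf⟩ := exists_linearIndependent_of_le_finrank hi
  refine ⟨(Submodule.span F (Set.range f)).map D.subtype, Submodule.map_subtype_le _ _, ?_⟩
  rw [Submodule.finrank_map_subtype_eq, finrank_span_eq_card hf, Fintype.card_fin]

theorem exists_codeSupp_card_eq_ghw (C : Submodule F (Fin n → F)) {i : ℕ}
    (hi : i ≤ finrank F C) :
    ∃ D ≤ C, finrank F D = i ∧ (codeSupp D).card = ghw C i := by
  obtain ⟨E, hE, hEi⟩ := exists_le_finrank_eq C hi
  exact Nat.sInf_mem (s := {s | ∃ D : Submodule F (Fin n → F), D ≤ C ∧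
    finrank F D = i ∧ (codeSupp D).card = s}) ⟨_, E, hE, hEi, rfl⟩

theorem ghw_le_length (C : Submodule F (Fin n → F)) {i : ℕ} (hi : i ≤ finrank F C) :
    ghw C i ≤ n := by
  obtain ⟨D, -, -, h⟩ := exists_codeSupp_card_eq_ghw C hi
  simpa [h] using (codeSupp D).card_le_univ

theorem ghw_le_iff (C : Submodule F (Fin n → F)) {i s : ℕ} (hi : i ≤ finrank F C) (hs : s ≤ n) :
    ghw C i ≤ s ↔ i ≤ dimProfile C s := by
  constructor
  · intro h
    obtain ⟨D, hD, rfl, hDs⟩ := exists_codeSupp_card_eq_ghw C hi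
    refine le_trans ?_ (dimProfile_mono C (hDs.trans_le h) hs)
    exact (Submodule.finrank_mono (le_inf hD (le_coordSubspace_iff.2 subset_rfl))).trans
      (finrank_inf_coordSubspace_le_dimProfile C _)
  · intro h
    obtain ⟨S, rfl, hS⟩ := exists_finrank_eq_dimProfile C hs
    obtain ⟨E, hE, hEi⟩ := exists_le_finrank_eq _ (h.trans_eq hS.symm)
    exact (Nat.sInf_le ⟨E, hE.trans inf_le_left, hEi, rfl⟩ : ghw C i ≤ _).trans
      (Finset.card_le_card (le_coordSubspace_iff.1 (hE.trans inf_le_right)))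

theorem ghw_pos (C : Submodule F (Fin n → F)) {i : ℕ} (hi1 : 1 ≤ i) (hi : i ≤ finrank F C) :
    1 ≤ ghw C i := by
  by_contra h
  have := (ghw_le_iff C hi (Nat.zero_le n)).1 (by lia)
  rw [dimProfile_zero] at this
  lia

theorem dimProfile_ghw (C : Submodule F (Fin n → F)) {i : ℕ} (hi1 : 1 ≤ i)
    (hi : i ≤ finrank F C) :
    dimProfile C (ghw C i) = i ∧ dimProfile C (ghw C i - 1) + 1 = i := by
  have hn := ghw_le_length C hi
  have hp := ghw_pos C hi1 hi
  have h₁ := (ghw_le_iff C hi hn).1 le_rfl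
  have h₂ := (ghw_le_iff C hi (s := ghw C i - 1) (by lia)).not.1 (by lia)
  have h₃ := dimProfile_succ_le C (s := ghw C i - 1) (by lia)
  rw [Nat.sub_add_cancel hp] at h₃
  lia

theorem ghw_lt_ghw (C : Submodule F (Fin n → F)) {i j : ℕ} (hi1 : 1 ≤ i) (hij : i < j)
    (hj : j ≤ finrank F C) : ghw C i < ghw C j := by
  by_contra! h
  have hi : i ≤ finrank F C := hij.le.trans hj
  have := (ghw_le_iff C hj (ghw_le_length C hi)).1 h
  have := (dimProfile_ghw C hi1 hi).1
  lia

theorem exists_ghw_eq_iff (C : Submodule F (Fin n → F)) {s : ℕ} (hs : s + 1 ≤ n) :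
    (∃ i, (1 ≤ i ∧ i ≤ finrank F C) ∧ ghw C i = s + 1) ↔
      dimProfile C (s + 1) = dimProfile C s + 1 := by
  constructor
  · rintro ⟨i, ⟨hi1, hi⟩, h⟩
    have := dimProfile_ghw C hi1 hi
    rw [h, Nat.add_sub_cancel] at this
    lia
  · intro h
    have hk := dimProfile_le_finrank C (s + 1)
    refine ⟨dimProfile C (s + 1), ⟨by lia, hk⟩, le_antisymm ((ghw_le_iff C hk hs).2 le_rfl) ?_⟩
    by_contra hlt
    have := (ghw_le_iff C hk (s := s) (by lia)).1 (by lia)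
    lia

theorem gapSet_dualCode (C : Submodule F (Fin n → F)) :
    gapSet (dualCode C) =
      (Finset.Icc 1 (finrank F C)).image fun i => n + 1 - ghw C i := by
  ext s
  simp only [gapSet, Finset.mem_sdiff, Finset.mem_image, Finset.mem_Icc]
  have key : ∀ t, t + 1 ≤ n →
      ((¬ ∃ i, (1 ≤ i ∧ i ≤ finrank F (dualCode C)) ∧ ghw (dualCode C) i = t + 1) ↔
        ∃ i, (1 ≤ i ∧ i ≤ finrank F C) ∧ ghw C i = n - (t + 1) + 1) := by
    intro t ht
    rw [exists_ghw_eq_iff _ ht, exists_ghw_eq_iff C (by lia)]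
    have h₁ := dimProfile_dualCode C ht
    have h₂ := dimProfile_dualCode C (s := t) (by lia)
    have h₃ := dimProfile_mono (dualCode C) (Nat.le_succ t) ht
    have h₄ := dimProfile_succ_le (dualCode C) ht
    rw [show n - t = n - (t + 1) + 1 by lia] at h₂
    simp only [Nat.succ_eq_add_one] at h₃
    lia
  constructor
  · rintro ⟨⟨hs1, hsn⟩, h⟩
    obtain ⟨t, rfl⟩ := Nat.exists_eq_add_of_le' hs1
    obtain ⟨i, hi, h⟩ := (key t hsn).1 h
    exact ⟨i, hi, by lia⟩
  · rintro ⟨i, hi, rfl⟩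
    have hp := ghw_pos C hi.1 hi.2
    have hn := ghw_le_length C hi.2
    refine ⟨by lia, ?_⟩
    rw [show n + 1 - ghw C i = n - ghw C i + 1 by lia]
    exact (key _ (by lia)).2 ⟨i, hi, by lia⟩

theorem card_gapSet_dualCode (C : Submodule F (Fin n → F)) :
    (gapSet (dualCode C)).card = finrank F C := by
  rw [gapSet_dualCode, Finset.card_image_of_injOn, Nat.card_Icc, Nat.add_sub_cancel]
  intro i hi j hj hij
  simp only [Finset.coe_Icc, Set.mem_Icc] at hi hj hij
  have hni := ghw_le_length C hi.2
  have hnj := ghw_le_length C hj.2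
  rcases lt_trichotomy i j with h | h | h
  · have := ghw_lt_ghw C hi.1 h hj.2
    lia
  · exact h
  · have := ghw_lt_ghw C hj.1 h hi.2
    lia

theorem gapNum_dualCode (C : Submodule F (Fin n → F)) {i : ℕ} (hi1 : 1 ≤ i)
    (hi : i ≤ finrank F C) :
    gapNum (dualCode C) (finrank F C - i + 1) = n + 1 - ghw C i := by
  have hcard := card_gapSet_dualCode C
  have huniq := Finset.orderEmbOfFin_unique hcard
    (f := fun j : Fin (finrank F C) => n + 1 - ghw C (finrank F C - j))
    (fun j => by
      rw [gapSet_dualCode]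
      exact Finset.mem_image_of_mem (fun i => n + 1 - ghw C i)
        (Finset.mem_Icc.2 ⟨by lia, Nat.sub_le _ _⟩))
    (fun a b hab => by
      have := ghw_lt_ghw C (i := finrank F C - b) (j := finrank F C - a) (by lia) (by lia)
        (Nat.sub_le _ _)
      have := ghw_le_length C (i := finrank F C - a) (Nat.sub_le _ _)
      dsimp only
      lia)
  have h := congrFun huniq ⟨finrank F C - i, by lia⟩
  rw [Finset.orderEmbOfFin_apply] at h
  dsimp only at h
  rw [Nat.sub_sub_self hi] at h
  rw [gapNum, Nat.add_sub_cancel, List.getD_eq_getElem _ _ (by rw [Finset.length_sort]; lia), h]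
  rfl

theorem codeSupp_span_singleton (v : Fin n → F) :
    codeSupp (Submodule.span F {v}) = vsupp v := by
  ext i
  simp only [mem_codeSupp, vsupp, Finset.mem_filter, Finset.mem_univ, true_and]
  constructor
  · rintro ⟨w, hw, hwi⟩ hvi
    obtain ⟨c, rfl⟩ := Submodule.mem_span_singleton.1 hw
    simp [hvi] at hwi
  · exact fun h => ⟨v, Submodule.mem_span_singleton_self v, h⟩

theorem dmin_eq_ghw_one (C : Submodule F (Fin n → F)) : dmin C = ghw C 1 := by
  unfold dmin ghw
  congr 1
  ext w
  constructor
  · rintro ⟨v, hv, hv0, rfl⟩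
    exact ⟨Submodule.span F {v}, (Submodule.span_singleton_le_iff_mem v C).2 hv,
      finrank_span_singleton hv0, by rw [codeSupp_span_singleton]⟩
  · rintro ⟨D, hD, hD1, rfl⟩
    obtain ⟨⟨v, hvD⟩, hv0, hv⟩ := finrank_eq_one_iff'.1 hD1
    have hspan : D = Submodule.span F {v} := by
      refine le_antisymm (fun w hw => ?_) ((Submodule.span_singleton_le_iff_mem v D).2 hvD)
      obtain ⟨c, hc⟩ := hv ⟨w, hw⟩
      exact Submodule.mem_span_singleton.2 ⟨c, congrArg Subtype.val hc⟩
    refine ⟨v, hD hvD, fun h => hv0 (Subtype.ext h), ?_⟩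
    rw [hspan, codeSupp_span_singleton]

end WeiDuality

/-- Wei's duality for GHWs: for an `[n,k]` code `C` with `1 ≤ k ≤ n-1`,
the dual code has dimension `n-k`, exactly `k` gaps, and
`d_i(C) = (n+1) - g^⊥_{k-i+1}`; in particular `d_min(C) = d_1(C) = (n+1) - g^⊥_k`. -/
theorem stmt0 {F : Type*} [Field F] {n k : ℕ} (C : Submodule F (Fin n → F))
    (hC : Module.finrank F C = k) (hk1 : 1 ≤ k) (hkn : k ≤ n - 1) :
    Module.finrank F (dualCode C) = n - k ∧
    (gapSet (dualCode C)).card = k ∧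
    (∀ i, 1 ≤ i → i ≤ k → ghw C i = (n + 1) - gapNum (dualCode C) (k - i + 1)) ∧
    dmin C = ghw C 1 ∧
    dmin C = (n + 1) - gapNum (dualCode C) k := by
  subst hC
  have main : ∀ i, 1 ≤ i → i ≤ Module.finrank F C →
      ghw C i = (n + 1) - gapNum (dualCode C) (Module.finrank F C - i + 1) := by
    intro i hi1 hi
    rw [gapNum_dualCode C hi1 hi]
    have := ghw_le_length C hi
    lia
  refine ⟨finrank_dualCode C, card_gapSet_dualCode C, main, dmin_eq_ghw_one C, ?_⟩
  rw [dmin_eq_ghw_one, main 1 le_rfl hk1, Nat.sub_add_cancel hk1]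
end

section
/- Let B0 be an [n,t] linear code over the finite field F_q and let k be an integer with 1 ≤ k ≤ n − t. If q > k·n^k, then there exists an [n,k] linear code C over F_q such that (a) B0 is a subspace of the dual code C^⊥, and (b) every subset S of {1,…,n} with |S| = k that is a k-core of B0 is also a k-core of C^⊥. -/
open Module Pointwise in
/-- A vector space over a finite field is not the union of fewer than `|F|` proper subspaces. -/
theorem exists_forall_notMem_of_card_lt {F E ι : Type*} [Field F] [Fintype F] [AddCommGroup E]
    [Module F E] [FiniteDimensional F E] (s : Finset ι) (p : ι → Submodule F E)
    (hp : ∀ i ∈ s, p i ≠ ⊤) (hs : s.card < Fintype.card F) :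
    ∃ x, ∀ i ∈ s, x ∉ p i := by
  by_contra! h
  have hcovers : ⋃ i ∈ s, (0 : E) +ᵥ ((p i).toAddSubgroup : Set E) = Set.univ := by
    simpa [Set.eq_univ_iff_forall] using h
  obtain ⟨i, hi, -, hle⟩ := AddSubgroup.exists_index_le_card_of_leftCoset_cover hcovers
  have hindex : (p i).toAddSubgroup.index = Nat.card F ^ finrank F (E ⧸ p i) :=
    Module.natCard_eq_pow_finrank (K := F) (V := E ⧸ p i)
  have : Nontrivial (E ⧸ p i) := Submodule.Quotient.nontrivial_iff.mpr (hp i hi)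
  have hpow := Nat.le_self_pow (finrank_pos (R := F) (M := E ⧸ p i)).ne' (Nat.card F)
  rw [Nat.card_eq_fintype_card] at hpow hindex
  omega

open Module in
/-- A subspace disjoint from few subspaces can be enlarged, staying disjoint from each of them,
as long as the dimensions permit. -/
theorem exists_le_finrank_eq_forall_disjoint {F E : Type*} [Field F] [Fintype F] [AddCommGroup E]
    [Module F E] [FiniteDimensional F E] (s : Finset (Submodule F E))
    (hs : s.card < Fintype.card F) (hne : s.Nonempty) (B : Submodule F E) (m : ℕ)
    (hdim : ∀ V ∈ s, finrank F V + (finrank F B + m) ≤ finrank F E)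
    (hdisj : ∀ V ∈ s, Disjoint V B) :
    ∃ D, B ≤ D ∧ finrank F D = finrank F B + m ∧ ∀ V ∈ s, Disjoint V D := by
  induction m with
  | zero => exact ⟨B, le_rfl, rfl, hdisj⟩
  | succ m ih =>
    obtain ⟨D, hBD, hD, hVD⟩ := ih fun V hV => by have := hdim V hV; omega
    obtain ⟨x, hx⟩ := exists_forall_notMem_of_card_lt s (fun V => V ⊔ D) (fun V hV htop => by
      have hsup := Submodule.finrank_add_le_finrank_add_finrank V D
      rw [htop, finrank_top] at hsup
      have := hdim V hV
      omega) hs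
    obtain ⟨W, hW⟩ := hne
    have hxD : x ∉ D := fun h => hx W hW (Submodule.mem_sup_right h)
    refine ⟨D ⊔ F ∙ x, hBD.trans le_sup_left, ?_, fun V hV =>
      (hVD V hV).disjoint_sup_right_of_disjoint_sup_left
        (Submodule.disjoint_span_singleton_of_notMem (hx V hV))⟩
    have hx0 : x ≠ 0 := fun h => hxD (h ▸ D.zero_mem)
    have hadd := Submodule.finrank_sup_add_finrank_inf_eq D (F ∙ x)
    rw [(Submodule.disjoint_span_singleton_of_notMem hxD).eq_bot, finrank_bot,
      finrank_span_singleton hx0] at hadd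
    omega

theorem isCore_iff_disjoint {F : Type*} [Field F] {n : ℕ} (B : Submodule F (Fin n → F))
    (S : Finset (Fin n)) : isCore B S ↔ Disjoint (Pi.spanSubset F (S : Set (Fin n))) B := by
  have hsub (v : Fin n → F) : vsupp v ⊆ S ↔ v ∈ Pi.spanSubset F (S : Set (Fin n)) := by
    simp only [Pi.mem_spanSubset_iff, vsupp, Finset.subset_iff, Finset.mem_filter,
      Finset.mem_univ, true_and, Finset.mem_coe]
    exact forall_congr' fun _ => not_imp_comm
  simp only [isCore, Submodule.disjoint_def, hsub]
  exact forall_congr' fun v => by tauto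

open Module in
/-- Every code is the dual of a code of complementary dimension. -/
theorem exists_dualCode_eq {F : Type*} [Field F] {n : ℕ} (D : Submodule F (Fin n → F)) :
    ∃ C : Submodule F (Fin n → F), finrank F C = n - finrank F D ∧ dualCode C = D := by
  let b : LinearMap.BilinForm F (Fin n → F) := Matrix.toBilin' 1
  have hb (v w : Fin n → F) : b v w = ∑ i, v i * w i := by
    simp [b, Matrix.toBilin'_apply', dotProduct]
  have hnondeg : b.Nondegenerate :=
    LinearMap.BilinForm.nondegenerate_toBilin'_of_det_ne_zero' 1 (by simp)
  have hrefl : b.IsRefl := fun v w h => by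
    rw [hb] at h ⊢
    simpa only [mul_comm] using h
  have hdual (C : Submodule F (Fin n → F)) : dualCode C = b.orthogonal C := by
    ext w
    simp only [LinearMap.BilinForm.mem_orthogonal_iff, hb]
    rfl
  refine ⟨b.orthogonal D, ?_, ?_⟩
  · rw [LinearMap.BilinForm.finrank_orthogonal hnondeg, finrank_fin_fun]
  · rw [hdual, LinearMap.BilinForm.orthogonal_orthogonal hnondeg hrefl]

/-- Lemma 2 of the paper: over a finite field `F_q` with `q > k·n^k`,
for any `[n,t]` code `B0` and `1 ≤ k ≤ n - t` there is an `[n,k]` code `C` with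
`B0 ≤ C^⊥` such that every `k`-core of `B0` is a `k`-core of `C^⊥`. -/
theorem stmt2 {F : Type*} [Field F] [Fintype F] {n t k : ℕ}
    (B0 : Submodule F (Fin n → F)) (ht : Module.finrank F B0 = t)
    (hk1 : 1 ≤ k) (hkt : k ≤ n - t) (hq : Fintype.card F > k * n ^ k) :
    ∃ C : Submodule F (Fin n → F),
      Module.finrank F C = k ∧
      B0 ≤ dualCode C ∧
      (∀ S : Finset (Fin n), S.card = k → isCore B0 S → isCore (dualCode C) S) := by
  classical
  have htn : t ≤ n := by
    have := Submodule.finrank_le B0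
    rwa [ht, Module.finrank_fin_fun] at this
  let cores := (Finset.univ.powersetCard k).filter (isCore B0)
  have hcard : cores.card < Fintype.card F := calc
    cores.card ≤ (Finset.univ.powersetCard k : Finset (Finset (Fin n))).card :=
      Finset.card_filter_le _ _
    _ = n.choose k := by simp
    _ ≤ n ^ k := Nat.choose_le_pow n k
    _ ≤ k * n ^ k := Nat.le_mul_of_pos_left _ hk1
    _ < Fintype.card F := hq
  obtain ⟨D, hBD, hD, hdisj⟩ : ∃ D, B0 ≤ D ∧ Module.finrank F D = n - k ∧
      ∀ S ∈ cores, Disjoint (Pi.spanSubset F (S : Set (Fin n))) D := by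
    rcases cores.eq_empty_or_nonempty with hempty | hne
    · obtain ⟨D, hBD, hD, -⟩ := exists_le_finrank_eq_forall_disjoint {⊥}
        (by simpa using Fintype.one_lt_card) (Finset.singleton_nonempty _) B0 (n - t - k)
        (by simp; omega) (by simp)
      exact ⟨D, hBD, by omega, by simp [hempty]⟩
    · obtain ⟨D, hBD, hD, hdisj⟩ := exists_le_finrank_eq_forall_disjoint
        (cores.image fun S : Finset (Fin n) => Pi.spanSubset F (S : Set (Fin n)))
        (Finset.card_image_le.trans_lt hcard) (hne.image _) B0 (n - t - k)
        (Finset.forall_mem_image.mpr fun S hS => by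
          have hSk := (Finset.mem_powersetCard.mp (Finset.mem_filter.mp hS).1).2
          rw [Pi.dim_spanSubset, Set.ncard_coe_finset, Module.finrank_fin_fun]
          omega)
        (Finset.forall_mem_image.mpr fun S hS =>
          (isCore_iff_disjoint B0 S).mp (Finset.mem_filter.mp hS).2)
      exact ⟨D, hBD, by omega, Finset.forall_mem_image.mp hdisj⟩
  obtain ⟨C, hC, rfl⟩ := exists_dualCode_eq D
  refine ⟨C, by omega, hBD, fun S hS hcore => (isCore_iff_disjoint _ S).mpr (hdisj S ?_)⟩
  exact Finset.mem_filter.mpr ⟨Finset.mem_powersetCard.mpr ⟨Finset.subset_univ S, hS⟩, hcore⟩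
end

section
/- Let C be an [n,k] linear code over a field F that is locally 2-reconstructible with locality r, and let B0 be the subspace of C^⊥ spanned by all codewords of C^⊥ of Hamming weight at most r+1. Then dim(B0) ≥ 2n/(r+2). -/
/-- If every member of a finite family of sets indexed by `ι` is nonempty and distinct indices never
share the same singleton, then the sizes of the sets add up to at least `2 |ι| - |κ|`. -/
theorem two_mul_card_le_sum_card_add_card {ι κ : Type*} [Fintype ι] [Fintype κ]
    (T : ι → Finset κ) (hne : ∀ i, (T i).Nonempty)
    (hinj : ∀ i j l, T i = {l} → T j = {l} → i = j) :
    2 * Fintype.card ι ≤ ∑ i, (T i).card + Fintype.card κ := by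
  classical
  have hsingle : (Finset.univ.filter fun i => (T i).card = 1).card ≤ Fintype.card κ := by
    calc _ ≤ (Finset.powersetCard 1 (Finset.univ : Finset κ)).card := by
          refine Finset.card_le_card_of_injOn T (fun i hi => ?_) fun i hi j _ hij => ?_
          · simpa [Finset.mem_powersetCard] using hi
          · obtain ⟨l, hl⟩ := Finset.card_eq_one.mp (Finset.mem_filter.mp hi).2
            exact hinj i j l hl (hij ▸ hl)
      _ = Fintype.card κ := by simp
  have hsum : ∑ _i : ι, 2 ≤ ∑ i, ((T i).card + if (T i).card = 1 then 1 else 0) :=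
    Finset.sum_le_sum fun i _ => by
      have := (hne i).card_pos
      split_ifs <;> omega
  rw [Finset.sum_add_distrib, ← Finset.card_filter] at hsum
  simp only [Finset.sum_const, Finset.card_univ, smul_eq_mul] at hsum
  omega

/-- A coordinate at which some vector of the span of `f` is nonzero is covered by some `f l`. -/
theorem exists_apply_ne_zero_of_mem_span {F ι κ : Type*} [Field F] [Fintype κ]
    {f : κ → ι → F} {v : ι → F} (hv : v ∈ Submodule.span F (Set.range f)) {i : ι} (hi : v i ≠ 0) :
    ∃ l, f l i ≠ 0 := by
  obtain ⟨a, rfl⟩ := (Submodule.mem_span_range_iff_exists_fun F).mp hv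
  by_contra! h
  exact hi (by simp [h])

/-- If `f l` is the only vector of `f` nonzero at `i`, and also the only one nonzero at `j`, then
the vectors in the span of `f` vanish at `i` exactly when they vanish at `j`. -/
theorem apply_ne_zero_iff_of_mem_span {F ι κ : Type*} [Field F] [Fintype κ]
    {f : κ → ι → F} {i j : ι} {l : κ} (hi : ∀ t, f t i ≠ 0 ↔ t = l) (hj : ∀ t, f t j ≠ 0 ↔ t = l)
    {v : ι → F} (hv : v ∈ Submodule.span F (Set.range f)) : v i ≠ 0 ↔ v j ≠ 0 := by
  obtain ⟨a, rfl⟩ := (Submodule.mem_span_range_iff_exists_fun F).mp hv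
  have key : ∀ x : ι, (∀ t, f t x ≠ 0 ↔ t = l) → ((∑ t, a t • f t) x ≠ 0 ↔ a l ≠ 0) := by
    intro x hx
    rw [Finset.sum_apply, Finset.sum_eq_single l]
    · simp [(hx l).mpr rfl]
    · intro t _ ht
      have : f t x = 0 := not_not.mp (mt (hx t).mp ht)
      simp [this]
    · simp
  rw [key i hi, key j hj]

/-- Theorem 3 of the paper: for a locally 2-reconstructible code,
the span `B0` of dual codewords of weight `≤ r+1` satisfies `dim B0 ≥ 2n/(r+2)`. -/
theorem stmt7 {F : Type*} [Field F] {n k r : ℕ} (hr : 1 ≤ r)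
    (C : Submodule F (Fin n → F)) (hC : Module.finrank F C = k)
    (hloc : Locally2Recon C r) :
    (2 * n : ℚ) / (r + 2) ≤ (Module.finrank F (lowWtSpan C r) : ℚ) := by
  classical
  obtain ⟨m, hm, f, hf, hspan⟩ : ∃ m, m = Module.finrank F (lowWtSpan C r) ∧
      ∃ f : Fin m → Fin n → F, (∀ l, f l ∈ dualCode C ∧ (vsupp (f l)).card ≤ r + 1) ∧
        Submodule.span F (Set.range f) = lowWtSpan C r := by
    obtain ⟨f, hf, hspan, -⟩ := Submodule.exists_fun_fin_finrank_span_eq F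
      {c | c ∈ dualCode C ∧ (vsupp c).card ≤ r + 1}
    exact ⟨_, rfl, f, hf, hspan⟩
  rw [← hm]
  have hmem : ∀ c ∈ dualCode C, (vsupp c).card ≤ r + 1 →
      c ∈ Submodule.span F (Set.range f) := fun c hc hw =>
    hspan ▸ Submodule.subset_span ⟨hc, hw⟩
  let T : Fin n → Finset (Fin m) := fun i => Finset.univ.filter fun l => f l i ≠ 0
  have hcount : 2 * n ≤ ∑ i, (T i).card + m := by
    simpa using two_mul_card_le_sum_card_add_card T
      (fun i => by
        obtain ⟨c, hc, hw, hci⟩ := hloc.1 i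
        obtain ⟨l, hl⟩ := exists_apply_ne_zero_of_mem_span (hmem c hc hw) hci
        exact ⟨l, by simpa [T] using hl⟩)
      (fun i j l hi hj => by
        by_contra hij
        refine hloc.2 i j hij (Set.ext fun c => and_congr_right fun hc => and_congr_right fun hw => ?_)
        exact apply_ne_zero_iff_of_mem_span (l := l)
          (fun t => by simpa [T] using Finset.ext_iff.mp hi t)
          (fun t => by simpa [T] using Finset.ext_iff.mp hj t) (hmem c hc hw))
  have hdouble : ∑ i, (T i).card = ∑ l, (vsupp (f l)).card := by
    simpa [T, vsupp, Finset.bipartiteAbove, Finset.bipartiteBelow] using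
      Finset.sum_card_bipartiteAbove_eq_sum_card_bipartiteBelow
        (s := (Finset.univ : Finset (Fin n))) (t := (Finset.univ : Finset (Fin m)))
        fun i l => f l i ≠ 0
  have hweight : ∑ l, (vsupp (f l)).card ≤ m * (r + 1) := by
    simpa using Finset.sum_le_card_nsmul Finset.univ _ (r + 1) fun l _ => (hf l).2
  have hfinal : 2 * n ≤ m * (r + 2) := by linarith
  rw [div_le_iff₀ (by positivity)]
  exact_mod_cast hfinal
end

section
/- Let C be an [n,k] linear code over a field F that is locally 2-reconstructible with locality r. Then the rate of C satisfies k/n ≤ r/(r+2), i.e., k(r+2) ≤ rn. -/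
theorem finrank_add_finrank_dualCode_le {F : Type*} [Field F] {n : ℕ}
    (C : Submodule F (Fin n → F)) :
    Module.finrank F C + Module.finrank F (dualCode C) ≤ n := by
  have hle : (dualCode C).map (dotProductEquiv F (Fin n)).toLinearMap ≤ C.dualAnnihilator := by
    rintro _ ⟨w, hw, rfl⟩
    rw [Submodule.mem_dualAnnihilator]
    intro v hv
    simpa [dotProduct, mul_comm] using hw v hv
  have h1 := Submodule.finrank_mono hle
  have h2 := (dotProductEquiv F (Fin n)).finrank_map_eq (dualCode C)
  have h3 := Subspace.finrank_add_finrank_dualAnnihilator_eq C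
  rw [Module.finrank_fin_fun] at h3
  have h4 : Module.finrank F ((dualCode C).map (dotProductEquiv F (Fin n)).toLinearMap)
      = Module.finrank F (dualCode C) := h2
  omega

/-- If `c` is the only element of `b` covering the coordinates `i` and `j`, then these two
coordinates are proportional on the span of `b`. -/
theorem mul_eq_mul_of_mem_span {F : Type*} [Field F] {n : ℕ} {b : Set (Fin n → F)}
    {c : Fin n → F} {i j : Fin n} (hi : ∀ x ∈ b, x i ≠ 0 → x = c)
    (hj : ∀ x ∈ b, x j ≠ 0 → x = c) {w : Fin n → F} (hw : w ∈ Submodule.span F b) :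
    w i * c j = w j * c i := by
  induction hw using Submodule.span_induction with
  | mem x hx =>
    by_cases hxc : x = c
    · rw [hxc, mul_comm]
    · rw [not_not.mp (mt (hi x hx) hxc), not_not.mp (mt (hj x hx) hxc), zero_mul, zero_mul]
  | zero => simp
  | add x y _ _ hx hy => simp only [Pi.add_apply, add_mul, hx, hy]
  | smul a x _ hx => simp only [Pi.smul_apply, smul_eq_mul, mul_assoc, hx]

open Classical in
/-- The low-weight part of the dual of a locally 2-reconstructible code is large. -/
theorem two_mul_length_le_finrank_lowWtSpan_mul {F : Type*} [Field F] {n r : ℕ}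
    {C : Submodule F (Fin n → F)} (hloc : Locally2Recon C r) :
    2 * n ≤ Module.finrank F (lowWtSpan C r) * (r + 2) := by
  obtain ⟨b, hbs, hspan, hli⟩ := exists_linearIndependent F
    {c | c ∈ dualCode C ∧ (vsupp c).card ≤ r + 1}
  have : Fintype b := hli.setFinite.fintype
  have hcard : Module.finrank F (lowWtSpan C r) = b.toFinset.card := by
    rw [lowWtSpan, ← hspan, finrank_span_set_eq_card hli]
  have hmem {i : Fin n} {w : Fin n → F} (hw : w ∈ coveringParities C r i) :
      w ∈ Submodule.span F b := by
    rw [hspan]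
    exact Submodule.subset_span ⟨hw.1, hw.2.1⟩
  set f : Fin n → ℕ := fun i => (b.toFinset.filter (fun c => c i ≠ 0)).card with hf
  have hpos (i : Fin n) : 1 ≤ f i := by
    rw [hf, Nat.one_le_iff_ne_zero, Finset.card_ne_zero]
    by_contra hne
    rw [Finset.not_nonempty_iff_eq_empty, Finset.filter_eq_empty_iff] at hne
    obtain ⟨w, hw⟩ := hloc.1 i
    have hle : Submodule.span F b ≤ LinearMap.ker (LinearMap.proj i : (Fin n → F) →ₗ[F] F) :=
      Submodule.span_le.mpr fun x hx => by
        simpa using hne (Set.mem_toFinset.mpr hx)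
    exact hw.2.2 (by simpa using hle (hmem hw))
  have hsum : ∑ i, f i ≤ b.toFinset.card * (r + 1) := by
    calc ∑ i, f i = ∑ c ∈ b.toFinset, (vsupp c).card :=
        Finset.sum_card_bipartiteAbove_eq_sum_card_bipartiteBelow
          (fun (i : Fin n) (c : Fin n → F) => c i ≠ 0)
      _ ≤ b.toFinset.card • (r + 1) := Finset.sum_le_card_nsmul _ _ _ fun c hc =>
        (hbs (Set.mem_toFinset.mp hc)).2
  have hone : (Finset.univ.filter (fun i => f i = 1)).card ≤ b.toFinset.card := by
    refine Finset.card_le_card_of_forall_subsingleton (fun i c => c i ≠ 0) ?_ ?_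
    · intro i _
      obtain ⟨c, hc⟩ := Finset.card_pos.mp (hpos i)
      exact ⟨c, Finset.mem_filter.mp hc⟩
    · rintro c hc i ⟨hi, hci⟩ j ⟨hj, hcj⟩
      have huniq {l : Fin n} (hl : l ∈ Finset.univ.filter (fun i => f i = 1)) (hcl : c l ≠ 0) :
          ∀ x ∈ b, x l ≠ 0 → x = c := fun x hx hxl =>
        Finset.card_le_one.mp (Finset.mem_filter.mp hl).2.le x
          (Finset.mem_filter.mpr ⟨Set.mem_toFinset.mpr hx, hxl⟩) c
          (Finset.mem_filter.mpr ⟨hc, hcl⟩)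
      have hsub {p q : Fin n} (hp : ∀ x ∈ b, x p ≠ 0 → x = c) (hq : ∀ x ∈ b, x q ≠ 0 → x = c)
          (hcq : c q ≠ 0) : coveringParities C r p ⊆ coveringParities C r q := fun w hw =>
        ⟨hw.1, hw.2.1, left_ne_zero_of_mul
          (mul_eq_mul_of_mem_span hp hq (hmem hw) ▸ mul_ne_zero hw.2.2 hcq)⟩
      by_contra hij
      exact hloc.2 i j hij ((hsub (huniq hi hci) (huniq hj hcj) hcj).antisymm
        (hsub (huniq hj hcj) (huniq hi hci) hci))
  have htwo : 2 * n ≤ ∑ i, f i + (Finset.univ.filter (fun i => f i = 1)).card := by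
    rw [Finset.card_filter, ← Finset.sum_add_distrib]
    calc 2 * n = ∑ _i : Fin n, 2 := by simp [mul_comm]
      _ ≤ _ := Finset.sum_le_sum fun i _ => by
        have := hpos i
        split_ifs <;> omega
  rw [hcard]
  linarith

/-- Corollary 1 of the paper: the rate of a locally 2-reconstructible
code satisfies `k/n ≤ r/(r+2)`, i.e. `k(r+2) ≤ rn`. -/
theorem stmt8 {F : Type*} [Field F] {n k r : ℕ} (hr : 1 ≤ r)
    (C : Submodule F (Fin n → F)) (hC : Module.finrank F C = k)
    (hloc : Locally2Recon C r) :
    k * (r + 2) ≤ r * n := by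
  have hdual := finrank_add_finrank_dualCode_le C
  have hlow : Module.finrank F (lowWtSpan C r) ≤ Module.finrank F (dualCode C) :=
    Submodule.finrank_mono (Submodule.span_le.mpr fun _ hc => hc.1)
  have hlen := two_mul_length_le_finrank_lowWtSpan_mul hloc
  have hsum : k + Module.finrank F (lowWtSpan C r) ≤ n := by omega
  nlinarith [Nat.mul_le_mul_right (r + 2) hsum]
end

section
/- Let r ≥ 1 and let T be a finite set with |T| = n ≥ r+1. Let S_1, …, S_b be subsets of T such that the union of all the S_i equals T and |S_i| = r+1 for every i ∈ {1,…,b}. For 1 ≤ m ≤ b define f_m to be the minimum, over all subsets I of {1,…,b} with |I| = m, of the cardinality of the union of the sets S_i for i ∈ I. Then f_m ≤ e_m for every m ∈ {1,…,b}, where the sequence e_1,…,e_b is defined recursively by e_b = n and e_{m−1} = e_m − ⌈2 e_m / m⌉ + (r+1) for 2 ≤ m ≤ b. -/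
/-- Among the members of a finite family, each point of the union that avoids one of the
truncated unions is compensated by the number of sets containing it. -/
theorem card_filter_mem_biUnion_erase_add_two_le {ι α : Type*} [DecidableEq ι] [DecidableEq α]
    (S : ι → Finset α) (I : Finset ι) {x : α} (hx : x ∈ I.biUnion S) :
    (I.filter (fun i => x ∈ (I.erase i).biUnion S)).card + 2
      ≤ I.card + (I.filter (fun i => x ∈ S i)).card := by
  obtain ⟨i, hi, hxi⟩ := Finset.mem_biUnion.1 hx
  have hle := Finset.card_filter_le I (fun i => x ∈ (I.erase i).biUnion S)
  have hmem : i ∈ I.filter (fun i => x ∈ S i) := Finset.mem_filter.2 ⟨hi, hxi⟩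
  have hpos := Finset.card_pos.2 ⟨i, hmem⟩
  by_cases h : ∃ j ∈ I, j ≠ i ∧ x ∈ S j
  · obtain ⟨j, hj, hji, hxj⟩ := h
    have : 1 < (I.filter (fun i => x ∈ S i)).card :=
      Finset.one_lt_card.2 ⟨i, hmem, j, Finset.mem_filter.2 ⟨hj, hxj⟩, hji.symm⟩
    omega
  · have : (I.filter (fun i => x ∈ (I.erase i).biUnion S)).card < I.card := by
      refine Finset.card_lt_card (Finset.filter_ssubset.2 ⟨i, hi, fun hmem' => h ?_⟩)
      obtain ⟨j, hj, hxj⟩ := Finset.mem_biUnion.1 hmem'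
      exact ⟨j, Finset.mem_of_mem_erase hj, Finset.ne_of_mem_erase hj, hxj⟩
    omega

theorem sum_card_biUnion_erase_add_le {ι α : Type*} [DecidableEq ι] [DecidableEq α]
    (S : ι → Finset α) (I : Finset ι) :
    ∑ i ∈ I, ((I.erase i).biUnion S).card + 2 * (I.biUnion S).card
      ≤ I.card * (I.biUnion S).card + ∑ i ∈ I, (S i).card := by
  have double_count : ∀ V : ι → Finset α, (∀ i ∈ I, V i ⊆ I.biUnion S) →
      ∑ i ∈ I, (V i).card = ∑ x ∈ I.biUnion S, (I.filter (fun i => x ∈ V i)).card := by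
    intro V hV
    refine Eq.trans (Finset.sum_congr rfl fun i hi => ?_)
      (Finset.sum_card_bipartiteAbove_eq_sum_card_bipartiteBelow (fun i x => x ∈ V i))
    rw [Finset.bipartiteAbove, Finset.filter_mem_eq_inter,
      Finset.inter_eq_right.2 (hV i hi)]
  rw [double_count _ fun i _ => Finset.biUnion_subset_biUnion_of_subset_left S
      (Finset.erase_subset i I),
    double_count _ fun i hi => Finset.subset_biUnion_of_mem S hi]
  have := Finset.sum_le_sum fun x hx => card_filter_mem_biUnion_erase_add_two_le S I (x := x) hx
  simp only [Finset.sum_add_distrib, Finset.sum_const, smul_eq_mul] at this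
  linarith

/-- Some member of a nonempty uniform family can be removed so that the union shrinks by at
least the average number of points covered only once. -/
theorem exists_card_biUnion_erase_le {ι α : Type*} [DecidableEq ι] [DecidableEq α]
    (S : ι → Finset α) {k : ℕ} (hS : ∀ i, (S i).card = k) {I : Finset ι} (hI : I.Nonempty) :
    ∃ i ∈ I, (((I.erase i).biUnion S).card : ℤ) ≤
      (I.biUnion S).card - ⌈(2 * (I.biUnion S).card : ℚ) / I.card⌉ + k := by
  have hsum := sum_card_biUnion_erase_add_le S I
  simp only [hS, Finset.sum_const, smul_eq_mul] at hsum
  obtain ⟨i, hi, h⟩ : ∃ i ∈ I, I.card * ((I.erase i).biUnion S).card + 2 * (I.biUnion S).card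
      ≤ I.card * ((I.biUnion S).card + k) := by
    obtain ⟨i, hi, hmin⟩ := I.exists_min_image (fun i => ((I.erase i).biUnion S).card) hI
    have := Finset.card_nsmul_le_sum I _ _ hmin
    rw [smul_eq_mul] at this
    exact ⟨i, hi, by linarith⟩
  refine ⟨i, hi, ?_⟩
  have hpos : (0 : ℚ) < I.card := by exact_mod_cast hI.card_pos
  have hceil : ⌈(2 * (I.biUnion S).card : ℚ) / I.card⌉ ≤
      ((I.biUnion S).card : ℤ) + k - ((I.erase i).biUnion S).card := by
    rw [Int.ceil_le, div_le_iff₀ hpos]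
    have h' : (I.card * ((I.erase i).biUnion S).card + 2 * (I.biUnion S).card : ℚ)
      ≤ I.card * ((I.biUnion S).card + k) := by exact_mod_cast h
    push_cast
    linarith
  linarith

theorem monotone_sub_ceil_two_mul_div {m : ℕ} (hm : 2 ≤ m) :
    Monotone fun x : ℤ => x - ⌈(2 * (x : ℚ)) / (m : ℚ)⌉ := by
  intro x y hxy
  have hm' : (2 : ℚ) ≤ m := by exact_mod_cast hm
  have hxy' : (x : ℚ) ≤ y := by exact_mod_cast hxy
  have hceil : ⌈(2 * (y : ℚ)) / m⌉ ≤ ⌈(2 * (x : ℚ)) / m⌉ + (y - x) := by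
    rw [Int.ceil_le]
    push_cast
    have h₁ := Int.le_ceil ((2 * (x : ℚ)) / m)
    have h₂ : (2 * (y : ℚ)) / m ≤ (2 * (x : ℚ)) / m + (y - x) := by
      rw [div_add' _ _ _ (by linarith), div_le_div_iff_of_pos_right (by linarith)]
      nlinarith
    linarith
  change x - ⌈(2 * (x : ℚ)) / m⌉ ≤ y - ⌈(2 * (y : ℚ)) / m⌉
  linarith

/-- Lemma 4 of the paper: if `S_1,…,S_b ⊆ T` each of size `r+1`
cover `T` with `|T| = n ≥ r+1`, then the minimum size `f_m` of a union of `m` of the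
sets satisfies `f_m ≤ e_m`, with `e_b = n` and
`e_{m-1} = e_m - ⌈2e_m/m⌉ + (r+1)`. -/
theorem stmt9 {α : Type*} [DecidableEq α] {r b n : ℕ} (hr : 1 ≤ r)
    (T : Finset α) (hT : T.card = n) (hn : r + 1 ≤ n)
    (S : Fin b → Finset α)
    (hcover : Finset.univ.biUnion S = T)
    (hcard : ∀ i, (S i).card = r + 1)
    (e : ℕ → ℤ) (heb : e b = n)
    (herec : ∀ m, 2 ≤ m → m ≤ b →
      e (m - 1) = e m - ⌈(2 * (e m : ℚ)) / (m : ℚ)⌉ + (r + 1)) :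
    ∀ m, 1 ≤ m → m ≤ b →
      ((sInf {c : ℕ | ∃ I : Finset (Fin b), I.card = m ∧ (I.biUnion S).card = c} : ℕ) : ℤ) ≤ e m := by
  intro m hm hmb
  suffices h : ∃ I : Finset (Fin b), I.card = m ∧ ((I.biUnion S).card : ℤ) ≤ e m by
    obtain ⟨I, hI, hle⟩ := h
    refine le_trans (Int.ofNat_le.2 (Nat.sInf_le ?_)) hle
    exact ⟨I, hI, rfl⟩
  induction hmb using Nat.decreasingInduction with
  | self => exact ⟨Finset.univ, by simp, by rw [hcover, hT, heb]⟩
  | of_succ k hk ih =>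
    obtain ⟨I, hI, hle⟩ := ih (by omega)
    obtain ⟨i, hi, hstep⟩ :=
      exists_card_biUnion_erase_le S hcard (I := I) (Finset.card_pos.1 (by omega))
    refine ⟨I.erase i, by rw [Finset.card_erase_of_mem hi, hI, Nat.add_sub_cancel], ?_⟩
    have hrec := herec (k + 1) (by omega) hk
    have hmono := monotone_sub_ceil_two_mul_div (m := k + 1) (by omega) hle
    rw [hI] at hstep
    rw [Nat.add_sub_cancel] at hrec
    push_cast at hstep hrec hmono
    linarith
end

section
/- Let r ≥ 1 and b ≥ 1 be integers and let n be an integer with r+1 ≤ n ≤ b(r+1). Define the sequence e_1,…,e_b recursively by e_b = n and e_{m−1} = e_m − ⌈2 e_m / m⌉ + (r+1) for 2 ≤ m ≤ b. Then e_m ≤ m(r+1) for every m ∈ {1,…,b}. -/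
/-- the recursively defined sequence `e_m` (with `e_b = n ≤ b(r+1)`
and `e_{m-1} = e_m - ⌈2e_m/m⌉ + (r+1)`) satisfies `e_m ≤ m(r+1)` for all `1 ≤ m ≤ b`. -/
theorem stmt10 {r b n : ℕ} (hr : 1 ≤ r) (hb : 1 ≤ b)
    (hn1 : r + 1 ≤ n) (hn2 : n ≤ b * (r + 1))
    (e : ℕ → ℤ) (heb : e b = n)
    (herec : ∀ m, 2 ≤ m → m ≤ b →
      e (m - 1) = e m - ⌈(2 * (e m : ℚ)) / (m : ℚ)⌉ + (r + 1)) :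
    ∀ m, 1 ≤ m → m ≤ b → e m ≤ (m : ℤ) * (r + 1) := by
  intro m hm hmb
  induction hmb using Nat.decreasingInduction with
  | self => rw [heb]; exact_mod_cast hn2
  | of_succ k hk ih =>
    have hle : e (k + 1) ≤ ((k : ℤ) + 1) * (r + 1) := by exact_mod_cast ih (by lia)
    have hrec := herec (k + 1) (by lia) hk
    simp only [Nat.add_sub_cancel] at hrec
    set c := ⌈(2 * (e (k + 1) : ℚ)) / ((k + 1 : ℕ) : ℚ)⌉ with hc
    have hceil : 2 * e (k + 1) ≤ c * ((k : ℤ) + 1) := by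
      have h := Int.le_ceil ((2 * (e (k + 1) : ℚ)) / ((k + 1 : ℕ) : ℚ))
      rw [← hc, div_le_iff₀ (by positivity)] at h
      exact_mod_cast h
    have hk1 : (0 : ℤ) ≤ (k : ℤ) - 1 := by lia
    have hmul := mul_le_mul_of_nonneg_left hle hk1
    have hkey : e (k + 1) - c ≤ ((k : ℤ) - 1) * (r + 1) :=
      le_of_mul_le_mul_right (by linarith) (show (0 : ℤ) < k + 1 by positivity)
    linarith
end
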